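/- arXiv:2401.00103 — 4 statements merged into one kernel-verified Lean document; each statement's English description precedes it below -/
import Mathlib

section
/- Let U : ℝ → ℝ be continuously differentiable and strictly concave with U'(x) > 0 for all x, satisfying the Inada conditions U'(x) → ∞ as x → −∞ and U'(x) → 0 as x → +∞. Then the convex conjugate Ũ(z) = sup_{x ∈ ℝ} (U(x) − x·z) is strictly convex on (0,∞). -/
open Filter Set

/-- The convex conjugate `Ũ(z) = sup_{x ∈ ℝ} (U(x) − x·z)`. -/
noncomputable def convexConjugate (U : ℝ → ℝ) (z : ℝ) : ℝ :=
  sSup (Set.range fun x : ℝ => U x - x * z)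

/-- A differentiable concave function on `ℝ` lies below each of its tangent lines. -/
theorem ConcaveOn.le_add_deriv_mul_sub {f : ℝ → ℝ} (hf : ConcaveOn ℝ Set.univ f) {x : ℝ}
    (hx : DifferentiableAt ℝ f x) (y : ℝ) : f y ≤ f x + deriv f x * (y - x) := by
  rcases lt_trichotomy x y with h | rfl | h
  · have := hf.slope_le_deriv (Set.mem_univ x) (Set.mem_univ y) h hx
    rw [slope_def_field, div_le_iff₀ (by linarith)] at this
    linarith
  · simp
  · have := hf.deriv_le_slope (Set.mem_univ y) (Set.mem_univ x) h hx
    rw [slope_def_field, le_div_iff₀ (by linarith)] at this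
    linarith

/-- For a differentiable concave function, the supremum defining the conjugate at `U' x` is
attained at `x`. -/
theorem isGreatest_convexConjugate {U : ℝ → ℝ} (hU : ConcaveOn ℝ Set.univ U) {x : ℝ}
    (hx : DifferentiableAt ℝ U x) :
    IsGreatest (Set.range fun y : ℝ => U y - y * deriv U x) (U x - x * deriv U x) := by
  refine ⟨⟨x, rfl⟩, ?_⟩
  rintro _ ⟨y, rfl⟩
  have := hU.le_add_deriv_mul_sub hx y
  dsimp only
  linarith

/-- The Fenchel–Young inequality is strict away from the points where `U' = z`. -/
theorem sub_mul_lt_convexConjugate {U : ℝ → ℝ} {x z : ℝ} (hx : DifferentiableAt ℝ U x)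
    (hbdd : BddAbove (Set.range fun y : ℝ => U y - y * z)) (hne : deriv U x ≠ z) :
    U x - x * z < convexConjugate U z := by
  refine lt_of_le_of_ne (le_csSup hbdd ⟨x, rfl⟩) fun heq => hne ?_
  have hmax : IsLocalMax (fun y => U y - y * z) x :=
    Filter.Eventually.of_forall fun y => (le_csSup hbdd ⟨y, rfl⟩).trans_eq heq.symm
  have hderiv : HasDerivAt (fun y => U y - y * z) (deriv U x - 1 * z) x :=
    hx.hasDerivAt.sub ((hasDerivAt_id x).mul_const z)
  linarith [hmax.hasDerivAt_eq_zero hderiv]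

/-- Under the stated hypotheses on `U`, the convex conjugate
`Ũ(z) = sup_x (U(x) − x·z)` is strictly convex on `(0,∞)`. -/
theorem forward_conjugate_strictConvexOn (U : ℝ → ℝ)
    (hC1 : ContDiff ℝ 1 U)
    (hconc : StrictConcaveOn ℝ Set.univ U)
    (hpos : ∀ x : ℝ, 0 < deriv U x)
    (hInadaBot : Tendsto (deriv U) atBot atTop)
    (hInadaTop : Tendsto (deriv U) atTop (nhds 0)) :
    StrictConvexOn ℝ (Set.Ioi 0) (convexConjugate U) := by
  have hdiff : Differentiable ℝ U := hC1.differentiable one_ne_zero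
  have hsurj : ∀ z : ℝ, 0 < z → ∃ x, deriv U x = z := fun z hz =>
    mem_range_of_exists_le_of_exists_ge (hC1.continuous_deriv le_rfl)
      (hInadaTop.eventually (eventually_le_nhds hz)).exists
      (hInadaBot.eventually (eventually_ge_atTop z)).exists
  have hbdd : ∀ z : ℝ, 0 < z → BddAbove (Set.range fun y : ℝ => U y - y * z) := by
    intro z hz
    obtain ⟨x, rfl⟩ := hsurj z hz
    exact (isGreatest_convexConjugate hconc.concaveOn (hdiff x)).bddAbove
  refine ⟨convex_Ioi 0, ?_⟩
  intro z hz w hw hzw a b ha hb hab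
  simp only [smul_eq_mul]
  obtain ⟨x, hx⟩ := hsurj (a * z + b * w) (add_pos (mul_pos ha hz) (mul_pos hb hw))
  have hval : convexConjugate U (a * z + b * w) = U x - x * (a * z + b * w) := by
    rw [← hx]
    exact (isGreatest_convexConjugate hconc.concaveOn (hdiff x)).csSup_eq
  have hb' : b = 1 - a := by linarith
  have hz_ne : deriv U x ≠ z := by
    intro h
    have : b * (w - z) = 0 := by
      rw [h] at hx
      subst hb'
      linarith
    rcases mul_eq_zero.mp this with h | h
    · exact hb.ne' h
    · exact hzw (by linarith)
  have hz_lt := mul_lt_mul_of_pos_left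
    (sub_mul_lt_convexConjugate (hdiff x) (hbdd z hz) hz_ne) ha
  have hw_le : b * (U x - x * w) ≤ b * convexConjugate U w :=
    mul_le_mul_of_nonneg_left (le_csSup (hbdd w hw) ⟨x, rfl⟩) hb.le
  rw [hval]
  calc U x - x * (a * z + b * w) = a * (U x - x * z) + b * (U x - x * w) := by
        subst hb'
        ring
    _ < a * convexConjugate U z + b * convexConjugate U w := add_lt_add_of_lt_of_le hz_lt hw_le
end

section
/- Let (Ω, 𝓕, ℙ) be a probability space, let u : ℝ → ℝ be concave (hence continuous), and let X and P be real-valued random variables on Ω that are independent, with X integrable, E[X] = x, P essentially bounded, and u(X + P) integrable. Then E[u(X + P)] ≤ E[u(x + P)]. -/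
open MeasureTheory ProbabilityTheory

/-- Let `(Ω, 𝓕, ℙ)` be a probability space, `u : ℝ → ℝ` concave (hence
continuous), and let `X` and `P` be independent real random variables with `X` integrable,
`E[X] = x`, `P` essentially bounded and `u(X + P)` integrable. Then
`E[u(X + P)] ≤ E[u(x + P)]`. -/
theorem expected_utility_jensen_indep {Ω : Type*} [MeasurableSpace Ω]
    (μ : Measure Ω) [IsProbabilityMeasure μ]
    (u : ℝ → ℝ) (hconc : ConcaveOn ℝ Set.univ u) (hcont : Continuous u)
    (X P : Ω → ℝ) (hX : Measurable X) (hP : Measurable P)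
    (hindep : IndepFun X P μ)
    (hXint : Integrable X μ) (x : ℝ) (hXmean : (∫ ω, X ω ∂μ) = x)
    (hPbdd : ∃ C : ℝ, ∀ᵐ ω ∂μ, |P ω| ≤ C)
    (huXP : Integrable (fun ω => u (X ω + P ω)) μ) :
    (∫ ω, u (X ω + P ω) ∂μ) ≤ ∫ ω, u (x + P ω) ∂μ := by
  have := Measure.isProbabilityMeasure_map (μ := μ) hX.aemeasurable
  have := Measure.isProbabilityMeasure_map (μ := μ) hP.aemeasurable
  have hXP : Measurable fun ω => (X ω, P ω) := hX.prodMk hP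
  have hmap : μ.map (fun ω => (X ω, P ω)) = (μ.map X).prod (μ.map P) :=
    (indepFun_iff_map_prod_eq_prod_map_map hX.aemeasurable hP.aemeasurable).1 hindep
  have hu : Continuous fun z : ℝ × ℝ => u (z.1 + z.2) := by fun_prop
  have hux : Continuous fun p : ℝ => u (x + p) := by fun_prop
  have hint : Integrable (fun z : ℝ × ℝ => u (z.1 + z.2)) ((μ.map X).prod (μ.map P)) := by
    rw [← hmap, integrable_map_measure hu.aestronglyMeasurable hXP.aemeasurable]
    exact huXP
  have hXid : Integrable (fun a : ℝ => a) (μ.map X) :=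
    (integrable_map_measure aestronglyMeasurable_id hX.aemeasurable).2 hXint
  have hmean : ∫ a, a ∂(μ.map X) = x :=
    (integral_map hX.aemeasurable aestronglyMeasurable_id).trans hXmean
  have hbdd : Integrable (fun ω => u (x + P ω)) μ := by
    obtain ⟨C, hC⟩ := hPbdd
    obtain ⟨D, hD⟩ := (isCompact_Icc (a := -C) (b := C)).exists_bound_of_continuousOn
      hux.continuousOn
    exact Integrable.of_bound (hux.measurable.comp hP).aestronglyMeasurable D
      (hC.mono fun ω hω => hD _ (abs_le.1 hω))
  have hleft : ∫ ω, u (X ω + P ω) ∂μ = ∫ p, ∫ a, u (a + p) ∂(μ.map X) ∂(μ.map P) := by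
    rw [← integral_prod_symm _ hint, ← hmap,
      integral_map hXP.aemeasurable hu.aestronglyMeasurable]
  rw [hleft, ← integral_map hP.aemeasurable hux.aestronglyMeasurable]
  refine integral_mono_ae hint.integral_prod_right
    ((integrable_map_measure hux.aestronglyMeasurable hP.aemeasurable).2 hbdd) ?_
  filter_upwards [hint.prod_left_ae] with p hp
  have hmeanp : ∫ a, (a + p) ∂(μ.map X) = x + p := by
    rw [integral_add hXid (integrable_const p), hmean]
    simp
  simpa only [hmeanp] using hconc.le_map_integral hcont.continuousOn isClosed_univ
    (Filter.Eventually.of_forall fun a => Set.mem_univ (a + p))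
    (hXid.add (integrable_const p)) hp
end

section
/- Let (Ω, 𝓕, ℙ) be a probability space, let u : ℝ → ℝ be concave (hence continuous), and let P be an essentially bounded real-valued random variable. For each x ∈ ℝ let V(x) denote the supremum of E[u(X + P)] over all integrable real-valued random variables X on Ω that are independent of P, satisfy E[X] = x, and for which u(X + P) is integrable. Then V(x) = E[u(x + P)] for every x ∈ ℝ (the supremum being attained by the constant X ≡ x), and consequently the optimized certainty equivalent S(P) satisfies S(P) = sup_{x ∈ ℝ} (V(x) − x), i.e., S(P) equals the convex conjugate of V evaluated at 1. -/
open MeasureTheory ProbabilityTheory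

/-- The set of expected utilities `E[u(X + P)]` achievable by integrable random variables `X`
independent of `P` with mean `x` and `u(X + P)` integrable. -/
def achievableValues {Ω : Type*} [MeasurableSpace Ω] (μ : Measure Ω)
    (u : ℝ → ℝ) (P : Ω → ℝ) (x : ℝ) : Set ℝ :=
  {y | ∃ X : Ω → ℝ, Measurable X ∧ Integrable X μ ∧ IndepFun X P μ ∧
    (∫ ω, X ω ∂μ) = x ∧ Integrable (fun ω => u (X ω + P ω)) μ ∧
    y = ∫ ω, u (X ω + P ω) ∂μ}

/-- A continuous function of a shifted essentially bounded random variable is integrable. -/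
lemma Continuous.integrable_comp_const_add_of_ae_bdd {Ω : Type*} [MeasurableSpace Ω]
    {μ : Measure Ω} [IsFiniteMeasure μ] {u : ℝ → ℝ} (hcont : Continuous u)
    {P : Ω → ℝ} (hP : Measurable P) {C : ℝ} (hC : ∀ᵐ ω ∂μ, |P ω| ≤ C) (x : ℝ) :
    Integrable (fun ω => u (x + P ω)) μ := by
  obtain ⟨M, hM⟩ := (isCompact_Icc (a := -C) (b := C)).exists_bound_of_continuousOn
    (f := fun p => u (x + p)) (by fun_prop)
  refine Integrable.of_bound (hcont.measurable.comp (hP.const_add x)).aestronglyMeasurable M ?_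
  filter_upwards [hC] with ω hω
  exact hM _ (abs_le.mp hω)

/-- Jensen's inequality for a concave function of a sum of independent random variables:
averaging out one summand increases the expectation. -/
lemma ConcaveOn.integral_comp_add_le_of_indepFun {Ω : Type*} [MeasurableSpace Ω]
    {μ : Measure Ω} [IsProbabilityMeasure μ] {u : ℝ → ℝ} (hconc : ConcaveOn ℝ Set.univ u)
    (hcont : Continuous u) {X P : Ω → ℝ} (hXm : Measurable X) (hX : Integrable X μ)
    (hP : Measurable P) (hind : IndepFun X P μ)
    (hXP : Integrable (fun ω => u (X ω + P ω)) μ)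
    (hmean : Integrable (fun ω => u ((∫ ω', X ω' ∂μ) + P ω)) μ) :
    ∫ ω, u (X ω + P ω) ∂μ ≤ ∫ ω, u ((∫ ω', X ω' ∂μ) + P ω) ∂μ := by
  have hprod := (indepFun_iff_map_prod_eq_prod_map_map hXm.aemeasurable hP.aemeasurable).mp hind
  have : IsProbabilityMeasure (μ.map X) := Measure.isProbabilityMeasure_map hXm.aemeasurable
  have : IsProbabilityMeasure (μ.map P) := Measure.isProbabilityMeasure_map hP.aemeasurable
  have hsum : Continuous fun z : ℝ × ℝ => u (z.1 + z.2) := by fun_prop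
  have hshift : Continuous fun p : ℝ => u ((∫ ω, X ω ∂μ) + p) := by fun_prop
  have hint : Integrable (fun z : ℝ × ℝ => u (z.1 + z.2)) ((μ.map X).prod (μ.map P)) := by
    rw [← hprod]
    exact (integrable_map_measure hsum.aestronglyMeasurable
      (hXm.prodMk hP).aemeasurable).mpr hXP
  have hid : Integrable (fun a : ℝ => a) (μ.map X) :=
    (integrable_map_measure continuous_id.aestronglyMeasurable hXm.aemeasurable).mpr hX
  have hidmean : ∫ a, a ∂(μ.map X) = ∫ ω, X ω ∂μ :=
    integral_map hXm.aemeasurable continuous_id.aestronglyMeasurable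
  calc ∫ ω, u (X ω + P ω) ∂μ
      = ∫ z : ℝ × ℝ, u (z.1 + z.2) ∂((μ.map X).prod (μ.map P)) := by
        rw [← hprod, integral_map (hXm.prodMk hP).aemeasurable hsum.aestronglyMeasurable]
    _ = ∫ p, ∫ a, u (a + p) ∂(μ.map X) ∂(μ.map P) := integral_prod_symm _ hint
    _ ≤ ∫ p, u ((∫ ω, X ω ∂μ) + p) ∂(μ.map P) := by
        refine integral_mono_ae hint.integral_prod_right
          ((integrable_map_measure hshift.aestronglyMeasurable hP.aemeasurable).mpr hmean) ?_
        filter_upwards [hint.prod_left_ae] with p hp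
        have hadd : ∫ a, (a + p) ∂(μ.map X) = (∫ ω, X ω ∂μ) + p := by
          rw [integral_add hid (integrable_const p), hidmean]
          simp
        rw [← hadd]
        exact hconc.le_map_integral hcont.continuousOn isClosed_univ (by simp)
          (hid.add (integrable_const p)) hp
    _ = ∫ ω, u ((∫ ω', X ω' ∂μ) + P ω) ∂μ :=
        integral_map hP.aemeasurable hshift.aestronglyMeasurable

/-- Let `u` be concave (hence continuous) and `P` essentially bounded. For
each `x`, the value `V(x) = sup { E[u(X + P)] }` over integrable `X` independent of `P` with
`E[X] = x` and `u(X + P)` integrable satisfies `V(x) = E[u(x + P)]`, the supremum being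
attained by the constant `X ≡ x`; consequently the optimized certainty equivalent
`S(P) = sup_r (E[u(P − r)] + r)` equals `sup_x (V(x) − x)`, i.e. the convex conjugate of `V`
evaluated at `1`. -/
theorem oce_as_conjugate_of_value_function {Ω : Type*} [MeasurableSpace Ω]
    (μ : Measure Ω) [IsProbabilityMeasure μ]
    (u : ℝ → ℝ) (hconc : ConcaveOn ℝ Set.univ u) (hcont : Continuous u)
    (P : Ω → ℝ) (hP : Measurable P)
    (hPbdd : ∃ C : ℝ, ∀ᵐ ω ∂μ, |P ω| ≤ C) :
    (∀ x : ℝ, IsGreatest (achievableValues μ u P x) (∫ ω, u (x + P ω) ∂μ)) ∧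
    sSup (Set.range fun r : ℝ => (∫ ω, u (P ω - r) ∂μ) + r)
      = sSup (Set.range fun x : ℝ => sSup (achievableValues μ u P x) - x) := by
  obtain ⟨C, hC⟩ := hPbdd
  have hu := hcont.integrable_comp_const_add_of_ae_bdd hP hC
  have hmax : ∀ x : ℝ, IsGreatest (achievableValues μ u P x) (∫ ω, u (x + P ω) ∂μ) := by
    refine fun x => ⟨⟨fun _ => x, measurable_const, integrable_const x,
      indepFun_const_left x P, by simp, hu x, rfl⟩, ?_⟩
    rintro _ ⟨X, hXm, hX, hind, rfl, hXP, rfl⟩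
    exact hconc.integral_comp_add_le_of_indepFun hcont hXm hX hP hind hXP (hu _)
  refine ⟨hmax, ?_⟩
  simp only [fun x => (hmax x).csSup_eq]
  rw [← (Equiv.neg ℝ).surjective.range_comp (fun x => (∫ ω, u (x + P ω) ∂μ) - x)]
  simp [Function.comp_def, sub_eq_neg_add, add_comm]
end

section
/- Let (Ω, 𝓕, ℙ) be a probability space, let u : ℝ → ℝ be concave, let P₁, P₂ be essentially bounded real-valued random variables, and let λ ∈ (0,1). Assume the suprema defining S(P₁), S(P₂) and S(λP₁ + (1−λ)P₂) are finite. Then the optimized certainty equivalent is concave: S(λP₁ + (1−λ)P₂) ≥ λ·S(P₁) + (1−λ)·S(P₂). -/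
open MeasureTheory

/-- A continuous function of an almost surely bounded random variable is integrable. -/
theorem Continuous.integrable_comp_of_ae_abs_le {Ω : Type*} [MeasurableSpace Ω]
    {μ : Measure Ω} [IsFiniteMeasure μ] {u : ℝ → ℝ} (hu : Continuous u)
    {X : Ω → ℝ} (hX : Measurable X) {C : ℝ} (hC : ∀ᵐ ω ∂μ, |X ω| ≤ C) :
    Integrable (fun ω => u (X ω)) μ := by
  obtain ⟨M, hM⟩ := (isCompact_Icc (a := -C) (b := C)).exists_bound_of_continuousOn hu.continuousOn
  refine Integrable.of_bound (hu.measurable.comp hX).aestronglyMeasurable M ?_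
  filter_upwards [hC] with ω hω
  exact hM _ (abs_le.mp hω)

/-- If every convex combination of elements of `A` and `B` with weights `t` and `1 - t` is at most
`c`, then so is the corresponding combination of their suprema. -/
theorem combo_csSup_le {A B : Set ℝ} (hA : A.Nonempty) (hB : B.Nonempty) {t c : ℝ}
    (ht0 : 0 < t) (ht1 : t < 1) (h : ∀ a ∈ A, ∀ b ∈ B, t * a + (1 - t) * b ≤ c) :
    t * sSup A + (1 - t) * sSup B ≤ c := by
  have ht1' : 0 < 1 - t := sub_pos.mpr ht1
  have hB' : ∀ a ∈ A, sSup B ≤ (c - t * a) / (1 - t) := fun a ha =>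
    csSup_le hB fun b hb => by
      rw [le_div_iff₀ ht1']
      linarith [h a ha b hb]
  have hA' : sSup A ≤ (c - (1 - t) * sSup B) / t :=
    csSup_le hA fun a ha => by
      have := (le_div_iff₀ ht1').mp (hB' a ha)
      rw [le_div_iff₀ ht0]
      linarith
  linarith [(le_div_iff₀ ht0).mp hA']

/-- **concavity of the OCE.** Let `u : ℝ → ℝ` be concave, `P₁, P₂` essentially
bounded random variables, and `λ ∈ (0,1)`; assume the suprema defining `S(P₁)`, `S(P₂)` and
`S(λP₁ + (1−λ)P₂)` are finite. Then
`S(λP₁ + (1−λ)P₂) ≥ λ·S(P₁) + (1−λ)·S(P₂)` where `S(P) = sup_r (E[u(P − r)] + r)`. -/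
theorem oce_concave {Ω : Type*} [MeasurableSpace Ω]
    (μ : Measure Ω) [IsProbabilityMeasure μ]
    (u : ℝ → ℝ) (hconc : ConcaveOn ℝ Set.univ u)
    (P₁ P₂ : Ω → ℝ) (hP₁ : Measurable P₁) (hP₂ : Measurable P₂)
    (hP₁bdd : ∃ C : ℝ, ∀ᵐ ω ∂μ, |P₁ ω| ≤ C)
    (hP₂bdd : ∃ C : ℝ, ∀ᵐ ω ∂μ, |P₂ ω| ≤ C)
    (lam : ℝ) (hlam0 : 0 < lam) (hlam1 : lam < 1)
    (hbdd₁ : BddAbove (Set.range fun r : ℝ => (∫ ω, u (P₁ ω - r) ∂μ) + r))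
    (hbdd₂ : BddAbove (Set.range fun r : ℝ => (∫ ω, u (P₂ ω - r) ∂μ) + r))
    (hbddl : BddAbove (Set.range fun r : ℝ =>
      (∫ ω, u (lam * P₁ ω + (1 - lam) * P₂ ω - r) ∂μ) + r)) :
    lam * sSup (Set.range fun r : ℝ => (∫ ω, u (P₁ ω - r) ∂μ) + r)
        + (1 - lam) * sSup (Set.range fun r : ℝ => (∫ ω, u (P₂ ω - r) ∂μ) + r)
      ≤ sSup (Set.range fun r : ℝ =>
        (∫ ω, u (lam * P₁ ω + (1 - lam) * P₂ ω - r) ∂μ) + r) := by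
  obtain ⟨C₁, hC₁⟩ := hP₁bdd
  obtain ⟨C₂, hC₂⟩ := hP₂bdd
  have hu : Continuous u := continuousOn_univ.mp (hconc.continuousOn isOpen_univ)
  have hlam1' : 0 < 1 - lam := sub_pos.mpr hlam1
  refine combo_csSup_le (Set.range_nonempty _) (Set.range_nonempty _) hlam0 hlam1 ?_
  rintro _ ⟨r₁, rfl⟩ _ ⟨r₂, rfl⟩
  refine le_csSup_of_le hbddl ⟨lam * r₁ + (1 - lam) * r₂, rfl⟩ ?_
  have hint₁ : Integrable (fun ω => u (P₁ ω - r₁)) μ :=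
    hu.integrable_comp_of_ae_abs_le (C := C₁ + |r₁|) (hP₁.sub_const r₁) <| by
      filter_upwards [hC₁] with ω hω
      exact (abs_sub _ _).trans (by gcongr)
  have hint₂ : Integrable (fun ω => u (P₂ ω - r₂)) μ :=
    hu.integrable_comp_of_ae_abs_le (C := C₂ + |r₂|) (hP₂.sub_const r₂) <| by
      filter_upwards [hC₂] with ω hω
      exact (abs_sub _ _).trans (by gcongr)
  have hint : Integrable
      (fun ω => u (lam * P₁ ω + (1 - lam) * P₂ ω - (lam * r₁ + (1 - lam) * r₂))) μ := by
    refine hu.integrable_comp_of_ae_abs_le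
      (C := lam * C₁ + (1 - lam) * C₂ + |lam * r₁ + (1 - lam) * r₂|)
      (((hP₁.const_mul lam).add (hP₂.const_mul (1 - lam))).sub_const _) ?_
    filter_upwards [hC₁, hC₂] with ω h₁ h₂
    refine (abs_sub _ _).trans ?_
    gcongr
    refine (abs_add_le _ _).trans ?_
    rw [abs_mul, abs_mul, abs_of_pos hlam0, abs_of_pos hlam1']
    gcongr
  have key : lam * ∫ ω, u (P₁ ω - r₁) ∂μ + (1 - lam) * ∫ ω, u (P₂ ω - r₂) ∂μ
      ≤ ∫ ω, u (lam * P₁ ω + (1 - lam) * P₂ ω - (lam * r₁ + (1 - lam) * r₂)) ∂μ := by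
    rw [← integral_const_mul, ← integral_const_mul,
      ← integral_add (hint₁.const_mul lam) (hint₂.const_mul (1 - lam))]
    refine integral_mono ((hint₁.const_mul lam).add (hint₂.const_mul (1 - lam))) hint fun ω => ?_
    have h := hconc.2 (Set.mem_univ (P₁ ω - r₁)) (Set.mem_univ (P₂ ω - r₂)) hlam0.le hlam1'.le
      (add_sub_cancel lam 1)
    simp only [smul_eq_mul] at h
    refine h.trans_eq (congrArg u ?_)
    ring
  linarith
end
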